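/- For every integer l ≥ 2 there exists L(l) ∈ ℕ such that: for every k ∈ ℕ, every real numbers α_1, ..., α_k with {1, α_1, ..., α_k} linearly independent over ℚ, and every ε with 0 < ε < 1/(2l²), there exists K ∈ ℕ such that for every v > 0 and every N_1 ∈ ℕ there exists N' ∈ ℕ with N' ≥ N_1 with the following property: for every real number θ and every interval I ⊂ [0,1) of length 1/l, if for every integer m ∈ [N_1, N'] satisfying ‖m α_i‖ < ε for all i = 1, ..., k one has m θ [1] ∉ I, then there exist integers r_1, ..., r_k and l' with |r_i| < K for all i and 0 < |l'| < L(l) such that ‖r_1 α_1 + ⋯ + r_k α_k − l' θ‖ < v. -/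

import Mathlib

open Filter

/-- Distance from a real number to the nearest integer. -/
noncomputable def distToInt (x : ℝ) : ℝ := |x - round x|

lemma mFourier_eq_toCircle {d : Type*} [Fintype d] (n : d → ℤ) (x : UnitAddTorus d) :
    UnitAddTorus.mFourier n x = (AddCircle.toCircle (∑ i, n i • x i) : ℂ) := by
  simp only [UnitAddTorus.mFourier, ContinuousMap.coe_mk, fourier_apply]
  induction (Finset.univ : Finset d) using Finset.cons_induction with
  | empty => simp
  | cons a s has ih => rw [Finset.prod_cons, Finset.sum_cons, AddCircle.toCircle_add, ih]; simp

lemma mFourier_eq_one_iff {d : Type*} [Fintype d] (n : d → ℤ) (x : UnitAddTorus d) :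
    UnitAddTorus.mFourier n x = 1 ↔ ∑ i, n i • x i = 0 := by
  rw [mFourier_eq_toCircle]
  refine Circle.coe_eq_one.trans ?_
  rw [← AddCircle.toCircle_zero (T := 1)]
  exact (AddCircle.injective_toCircle one_ne_zero).eq_iff

lemma mFourier_apply_add {d : Type*} [Fintype d] (n : d → ℤ) (x y : UnitAddTorus d) :
    UnitAddTorus.mFourier n (x + y) = UnitAddTorus.mFourier n x * UnitAddTorus.mFourier n y := by
  simp only [mFourier_eq_toCircle, Pi.add_apply, smul_add, Finset.sum_add_distrib,
    AddCircle.toCircle_add, Circle.coe_mul]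

open MeasureTheory in
/-- A point of the torus on which every character trivial on the closed subgroup `H` is trivial
lies in `H`. -/
lemma UnitAddTorus.mem_of_forall_mFourier_eq_one {d : Type*} [Fintype d]
    (H : AddSubgroup (UnitAddTorus d)) (hH : IsClosed (H : Set (UnitAddTorus d)))
    (x : UnitAddTorus d)
    (h : ∀ n : d → ℤ, (∀ y ∈ H, UnitAddTorus.mFourier n y = 1) → UnitAddTorus.mFourier n x = 1) :
    x ∈ H := by
  classical
  by_contra hx
  have : CompactSpace H := isCompact_iff_compactSpace.mp hH.isCompact
  let μ : Measure H := Measure.addHaarMeasure ⊤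
  have hμ : IsProbabilityMeasure μ := ⟨by
    have := Measure.addHaarMeasure_self (K₀ := (⊤ : TopologicalSpace.PositiveCompacts H))
    simpa using this⟩
  have hint (p : C(UnitAddTorus d, ℂ)) (z : UnitAddTorus d) :
      Integrable (fun y : H => p (y + z)) μ :=
    Continuous.integrable_of_hasCompactSupport (by fun_prop) (HasCompactSupport.of_compactSpace _)
  have key (p : C(UnitAddTorus d, ℂ))
      (hp : p ∈ Submodule.span ℂ (Set.range (UnitAddTorus.mFourier (d := d)))) :
      ∫ y : H, p (y + x) ∂μ = ∫ y : H, p (y + 0) ∂μ := by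
    induction hp using Submodule.span_induction with
    | mem p hp =>
      obtain ⟨n, rfl⟩ := hp
      by_cases hn : ∀ y ∈ H, UnitAddTorus.mFourier n y = 1
      · simp only [mFourier_apply_add, h n hn, add_zero, mul_one]
      · push Not at hn
        obtain ⟨y₀, hy₀, hne⟩ := hn
        have h0 : ∫ y : H, UnitAddTorus.mFourier n (y : UnitAddTorus d) ∂μ = 0 := by
          have := integral_add_left_eq_self (μ := μ)
            (fun y : H => UnitAddTorus.mFourier n (y : UnitAddTorus d)) ⟨y₀, hy₀⟩
          simp only [AddSubgroup.coe_add, mFourier_apply_add, integral_const_mul] at this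
          have h2 : (UnitAddTorus.mFourier n y₀ - 1) *
            ∫ y : H, UnitAddTorus.mFourier n (y : UnitAddTorus d) ∂μ = 0 := by
            rw [sub_mul, this]; ring
          exact (mul_eq_zero.mp h2).resolve_left (sub_ne_zero.mpr hne)
        simp only [mFourier_apply_add, integral_mul_const, h0, zero_mul]
    | zero => simp
    | add p q _ _ hp hq =>
      simp only [ContinuousMap.add_apply]
      rw [integral_add (hint p x) (hint q x), integral_add (hint p 0) (hint q 0), hp, hq]
    | smul c p _ hp =>
      simp only [ContinuousMap.smul_apply, integral_smul, hp]
  obtain ⟨f, hf0, hf1, -⟩ := exists_continuous_zero_one_of_isClosed hH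
    (hH.preimage (f := fun y => y - x) (by fun_prop)) (by
      rw [Set.disjoint_left]
      intro y hy hyx
      exact hx (by simpa using H.sub_mem hy hyx))
  let g : C(UnitAddTorus d, ℂ) := ⟨fun y => (f y : ℂ), by fun_prop⟩
  have hg : g ∈ (Submodule.span ℂ
      (Set.range (UnitAddTorus.mFourier (d := d)))).topologicalClosure := by
    rw [UnitAddTorus.span_mFourier_closure_eq_top]; trivial
  obtain ⟨p, hp, hgp⟩ := Metric.mem_closure_iff.mp hg (1 / 3) (by norm_num)
  have happ (z : UnitAddTorus d) (c : ℂ) (hc : ∀ y ∈ H, g (y + z) = c) :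
      ‖∫ y : H, p (y + z) ∂μ - c‖ ≤ 1 / 3 := by
    have h1 : ∫ y : H, (p (y + z) - c) ∂μ = ∫ y : H, p (y + z) ∂μ - c := by
      rw [integral_sub (hint p z) (integrable_const c)]; simp
    rw [← h1]
    refine (norm_integral_le_of_norm_le_const (C := 1 / 3) (.of_forall fun y => ?_)).trans (by simp)
    rw [← hc y y.2, ← dist_eq_norm, dist_comm]
    exact (ContinuousMap.dist_apply_le_dist _).trans hgp.le
  have e0 := happ 0 0 fun y hy => by simpa [g] using hf0 hy
  have e1 := happ x 1 fun y hy => by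
    have : f (y + x) = 1 := hf1 (by simpa using hy)
    simp [g, this]
  rw [key p hp] at e1
  have := norm_sub_le (∫ y : H, p (y + 0) ∂μ - 0) (∫ y : H, p (y + 0) ∂μ - 1)
  norm_num at this e0 e1
  linarith

/-- Kronecker's theorem. -/
lemma UnitAddTorus.mapClusterPt_nsmul {d : Type*} [Fintype d] (g x : UnitAddTorus d)
    (h : ∀ n : d → ℤ, ∑ i, n i • g i = 0 → ∑ i, n i • x i = 0) :
    MapClusterPt x atTop (fun m : ℕ => m • g) := by
  rw [mapClusterPt_atTop_nsmul_iff_mem_topologicalClosure_zmultiples]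
  refine UnitAddTorus.mem_of_forall_mFourier_eq_one _
    (AddSubgroup.isClosed_topologicalClosure _) x fun n hn => ?_
  rw [mFourier_eq_one_iff]
  exact h n ((mFourier_eq_one_iff n g).mp
    (hn g (AddSubgroup.le_topologicalClosure _ (AddSubgroup.mem_zmultiples g))))

lemma norm_coe_unitAddCircle (x : ℝ) : ‖(x : UnitAddCircle)‖ = distToInt x :=
  UnitAddCircle.norm_eq

lemma UnitAddCircle.coe_eq_zero_iff_exists_int (x : ℝ) :
    (x : UnitAddCircle) = 0 ↔ ∃ p : ℤ, x = p := by
  rw [AddCircle.coe_eq_zero_iff]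
  simp [eq_comm]

/-- If `(x, y)` satisfies, modulo `1`, every integral relation satisfied by `(α, θ)`, then some
late multiple of `(α, θ)` is close to `(x, y)`. -/
lemma exists_multiple_mem_of_relations {k : ℕ} {α x : Fin k → ℝ} {θ y ε a b : ℝ}
    (ha : 0 ≤ a) (hb : b ≤ 1) (hx : ∀ i, |x i| < ε) (hy : y ∈ Set.Ioo a b)
    (h : ∀ (n : Fin k → ℤ) (n' : ℤ), (∃ p : ℤ, ∑ i, (n i : ℝ) * α i - n' * θ = p) →
      ∃ p : ℤ, ∑ i, (n i : ℝ) * x i - n' * y = p) (N : ℕ) :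
    ∃ m ≥ N, (∀ i, distToInt (m * α i) < ε) ∧ Int.fract (m * θ) ∈ Set.Ioo a b := by
  let g : UnitAddTorus (Option (Fin k)) := fun o => ((o.elim θ α : ℝ) : UnitAddCircle)
  let z : UnitAddTorus (Option (Fin k)) := fun o => ((o.elim y x : ℝ) : UnitAddCircle)
  have hz : MapClusterPt z atTop (fun m : ℕ => m • g) := by
    refine UnitAddTorus.mapClusterPt_nsmul g z fun n hn => ?_
    have e (t : ℝ) (s : Fin k → ℝ) :
        ∑ i, n i • ((i.elim t s : ℝ) : UnitAddCircle) =
          ((∑ i, (n (some i) : ℝ) * s i - (-n none : ℤ) * t : ℝ) : UnitAddCircle) := by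
      rw [Fintype.sum_option, show ∑ i, (n (some i) : ℝ) * s i - (-n none : ℤ) * t =
        n none • t + ∑ i, n (some i) • s i by simp; ring]
      simp
    simp only [g, z, e, UnitAddCircle.coe_eq_zero_iff_exists_int] at hn ⊢
    exact h _ _ hn
  have hU : {w : UnitAddTorus (Option (Fin k)) | (∀ i, ‖w (some i)‖ < ε) ∧
      w none ∈ ((↑) : ℝ → UnitAddCircle) '' Set.Ioo a b} ∈ nhds z := by
    refine IsOpen.mem_nhds ?_ ⟨fun i => ?_, y, hy, rfl⟩
    · refine IsOpen.and ?_ ?_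
      · rw [Set.ofPred_forall]
        exact isOpen_iInter_of_finite fun i => isOpen_lt (by fun_prop) continuous_const
      · exact (QuotientAddGroup.isOpenMap_coe _ isOpen_Ioo).preimage (f := fun w : UnitAddTorus (Option (Fin k)) => w none)
          (continuous_apply none)
    · change ‖((x i : ℝ) : UnitAddCircle)‖ < ε
      rw [norm_coe_unitAddCircle]
      exact (round_le (x i) 0).trans_lt (by simpa using hx i)
  obtain ⟨m, hm, hm1, t, ht, hmt⟩ := (frequently_atTop.1 (hz.frequently hU)) N
  refine ⟨m, hm, fun i => ?_, ?_⟩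
  · rw [← norm_coe_unitAddCircle]
    simpa [g] using hm1 i
  · have : ((m * θ - t : ℝ) : UnitAddCircle) = 0 := by
      rw [AddCircle.coe_sub, hmt, sub_eq_zero, ← nsmul_eq_mul]
      rfl
    rw [UnitAddCircle.coe_eq_zero_iff_exists_int] at this
    rwa [Int.fract_eq_iff.2 ⟨ha.trans ht.1.le, ht.2.trans_le hb, this⟩]

lemma eq_zero_of_sum_mul_eq_int {k : ℕ} {α : Fin k → ℝ}
    (hα : LinearIndependent ℚ (fun o : Option (Fin k) => o.elim (1 : ℝ) α))
    {r : Fin k → ℤ} {p : ℤ} (h : ∑ i, (r i : ℝ) * α i = p) : r = 0 := by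
  have := Fintype.linearIndependent_iff.1 hα (fun o => o.elim (-p : ℚ) fun i => (r i : ℚ)) (by
    simp [Fintype.sum_option, Rat.smul_def, h])
  funext i
  simpa using this (some i)

/-- The integral relations between `1`, the `α i` and `θ` are the multiples of a single one. -/
lemma exists_generator_relations {k : ℕ} {α : Fin k → ℝ}
    (hα : LinearIndependent ℚ (fun o : Option (Fin k) => o.elim (1 : ℝ) α)) (θ : ℝ) :
    ∃ (r : Fin k → ℤ) (q : ℤ), (∃ p : ℤ, ∑ i, (r i : ℝ) * α i - q * θ = p) ∧
      ∀ (n : Fin k → ℤ) (n' : ℤ), (∃ p : ℤ, ∑ i, (n i : ℝ) * α i - n' * θ = p) →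
        ∃ c : ℤ, n' = c * q ∧ ∀ i, n i = c * r i := by
  let D : AddSubgroup ℤ :=
    { carrier := {n' | ∃ (n : Fin k → ℤ) (p : ℤ), ∑ i, (n i : ℝ) * α i - n' * θ = p}
      zero_mem' := ⟨0, 0, by simp⟩
      add_mem' := by
        rintro s t ⟨n, p, h⟩ ⟨n', p', h'⟩
        refine ⟨n + n', p + p', ?_⟩
        push_cast [Pi.add_apply, add_mul, Finset.sum_add_distrib]
        linarith
      neg_mem' := by
        rintro s ⟨n, p, h⟩
        refine ⟨-n, -p, ?_⟩
        push_cast [Pi.neg_apply, neg_mul, Finset.sum_neg_distrib]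
        linarith }
  obtain ⟨q, hq⟩ := Int.subgroup_cyclic D
  obtain ⟨r, p, hr⟩ : q ∈ D := hq ▸ AddSubgroup.mem_closure_singleton_self q
  refine ⟨r, q, ⟨p, hr⟩, fun n n' ⟨p', hn⟩ => ?_⟩
  have hn' : n' ∈ D := ⟨n, p', hn⟩
  rw [hq, AddSubgroup.mem_closure_singleton] at hn'
  obtain ⟨c, rfl⟩ := hn'
  refine ⟨c, rfl, fun i => ?_⟩
  have := eq_zero_of_sum_mul_eq_int hα (r := n - c • r) (p := p' - c * p) (by
    push_cast [Pi.sub_apply, Pi.smul_apply, smul_eq_mul, sub_mul, Finset.sum_sub_distrib, mul_assoc,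
      ← Finset.mul_sum] at hn ⊢
    rw [← hn, ← hr]; ring)
  simpa [sub_eq_zero] using congrFun this i

/-- If `θ` avoids an open interval of length `1 / l` along all large return times of `α`, then
`θ` satisfies an exact bounded integral relation with the `α i`. -/
lemma exists_relation_of_avoids {l k : ℕ} (hl : 0 < l) {α : Fin k → ℝ}
    (hα : LinearIndependent ℚ (fun o : Option (Fin k) => o.elim (1 : ℝ) α))
    {ε θ a : ℝ} (hε : 0 < ε) (ha : 0 ≤ a) (hal : a + 1 / (l : ℝ) ≤ 1) {N : ℕ}
    (h : ∀ m : ℕ, N ≤ m → (∀ i, distToInt (m * α i) < ε) →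
      Int.fract (m * θ) ∉ Set.Ioo a (a + 1 / (l : ℝ))) :
    ∃ (r : Fin k → ℤ) (q : ℤ), (∀ i, |r i| < ((⌊l / ε⌋₊ + 1 : ℕ) : ℤ)) ∧ q ≠ 0 ∧
      |q| < ((l + 1 : ℕ) : ℤ) ∧ ∃ p : ℤ, ∑ i, (r i : ℝ) * α i - q * θ = p := by
  have hl0 : (0 : ℝ) < l := by exact_mod_cast hl
  have hl1 : (0 : ℝ) < 1 / l := by positivity
  obtain ⟨r, q, hrel, hgen⟩ := exists_generator_relations hα θ
  have avoid (x : Fin k → ℝ) (y : ℝ) (hx : ∀ i, |x i| < ε)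
      (hy : y ∈ Set.Ioo a (a + 1 / (l : ℝ))) :
      ¬ ∃ p : ℤ, ∑ i, (r i : ℝ) * x i - q * y = p := by
    rintro ⟨p, hp⟩
    obtain ⟨m, hm, hm1, hm2⟩ := exists_multiple_mem_of_relations ha hal hx hy
      (α := α) (θ := θ) (fun n n' hn => by
        obtain ⟨c, rfl, hc⟩ := hgen n n' hn
        refine ⟨c * p, ?_⟩
        push_cast [hc, mul_assoc, ← Finset.mul_sum]
        rw [← hp]; ring) N
    exact h m hm hm1 hm2
  have hmid : a + 1 / (l : ℝ) / 2 ∈ Set.Ioo a (a + 1 / (l : ℝ)) := ⟨by linarith, by linarith⟩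
  have hq0 : q ≠ 0 := by
    rintro rfl
    exact avoid 0 _ (fun _ => by simpa using hε) hmid ⟨0, by simp⟩
  have hq0' : (0 : ℝ) < |(q : ℝ)| := by positivity
  have hql : |q| < ((l + 1 : ℕ) : ℤ) := by
    by_contra! hlt
    have hlt' : (l : ℝ) + 1 ≤ |(q : ℝ)| := by exact_mod_cast hlt
    refine avoid 0 ((⌊a * |(q : ℝ)|⌋ + 1) / |(q : ℝ)|) (fun _ => by simpa using hε) ⟨?_, ?_⟩ ?_
    · rw [lt_div_iff₀ hq0']
      exact Int.lt_floor_add_one _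
    · rw [div_lt_iff₀ hq0', add_mul]
      have h1 : 1 < 1 / (l : ℝ) * |(q : ℝ)| := by
        rw [one_div_mul_eq_div, lt_div_iff₀ hl0]
        linarith
      linarith [Int.floor_le (a * |(q : ℝ)|)]
    · have hqne : (q : ℝ) ≠ 0 := by exact_mod_cast hq0
      rcases abs_choice (q : ℝ) with hs | hs
      · exact ⟨-(⌊a * |(q : ℝ)|⌋ + 1), by push_cast; rw [hs]; simp; field_simp; ring⟩
      · exact ⟨⌊a * |(q : ℝ)|⌋ + 1, by push_cast; rw [hs]; simp; field_simp⟩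
  refine ⟨r, q, fun i => ?_, hq0, hql, hrel⟩
  by_contra! hlt
  have hlt1 : ((⌊l / ε⌋₊ + 1 : ℕ) : ℝ) ≤ |(r i : ℝ)| := by exact_mod_cast hlt
  have hlt2 : l / ε < |(r i : ℝ)| := (by simpa using Nat.lt_floor_add_one (l / ε) :
    l / ε < ((⌊l / ε⌋₊ + 1 : ℕ) : ℝ)).trans_le hlt1
  have hr0 : (0 : ℝ) < |(r i : ℝ)| := lt_trans (by positivity) hlt2
  have hrne : (r i : ℝ) ≠ 0 := abs_pos.1 hr0
  have hqle : |(q : ℝ)| ≤ l := by exact_mod_cast Int.lt_add_one_iff.1 (by exact_mod_cast hql)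
  refine avoid (Pi.single i (q * (a + 1 / (l : ℝ) / 2) / r i)) _ (fun j => ?_) hmid ⟨0, ?_⟩
  · rcases eq_or_ne j i with rfl | hj
    · rw [Pi.single_eq_same, abs_div, abs_mul, div_lt_iff₀ hr0]
      rw [div_lt_iff₀ hε] at hlt2
      have hy : |a + 1 / (l : ℝ) / 2| ≤ 1 := by
        rw [abs_of_nonneg (by positivity)]
        linarith
      nlinarith [abs_nonneg (a + 1 / (l : ℝ) / 2), abs_nonneg (q : ℝ)]
    · simpa [Pi.single_eq_of_ne hj] using hε
  · simp only [Pi.single_apply, mul_ite, mul_zero, Finset.sum_ite_eq', Finset.mem_univ, if_true]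
    field_simp
    simp

/-- Generalisation of Lemma 1 of Fayad–Thouvenot: for every `l ≥ 2` there is `L = L(l)`,
independent of `k` and of the rationally independent numbers `α_1, …, α_k`, such that for
every `0 < ε < 1/(2l²)` there is `K` so that for every `v > 0` and `N₁` there is `N' ≥ N₁`
with: whenever `θ` avoids an interval `I ⊆ [0,1)` of length `1/l` along all `m ∈ [N₁, N']`
with `‖m α_i‖ < ε` for all `i`, there are integers `|r_i| < K` and `0 < |l'| < L` with
`‖∑ r_i α_i − l' θ‖ < v`. -/
theorem stmt3 (l : ℕ) (hl : 2 ≤ l) :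
    ∃ L : ℕ, ∀ (k : ℕ) (α : Fin k → ℝ),
      LinearIndependent ℚ (fun o : Option (Fin k) => o.elim (1:ℝ) α) →
      ∀ ε : ℝ, 0 < ε → ε < 1 / (2 * (l:ℝ)^2) →
      ∃ K : ℕ, ∀ v : ℝ, 0 < v → ∀ N₁ : ℕ, ∃ N' : ℕ, N₁ ≤ N' ∧
        ∀ (θ : ℝ) (a : ℝ), 0 ≤ a → a + 1 / (l:ℝ) ≤ 1 →
          (∀ m : ℕ, N₁ ≤ m → m ≤ N' →
            (∀ i : Fin k, distToInt ((m : ℝ) * α i) < ε) →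
            Int.fract ((m : ℝ) * θ) ∉ Set.Ico a (a + 1 / (l:ℝ))) →
          ∃ (r : Fin k → ℤ) (l' : ℤ), (∀ i, |r i| < (K : ℤ)) ∧
            l' ≠ 0 ∧ |l'| < (L : ℤ) ∧
            distToInt ((∑ i, (r i : ℝ) * α i) - (l' : ℝ) * θ) < v := by
  have hl0 : 0 < l := by omega
  have hlR : (0 : ℝ) < l := by exact_mod_cast hl0
  refine ⟨l + 1, fun k α hα ε hε _ => ⟨⌊l / ε⌋₊ + 1, fun v hv N₁ => ?_⟩⟩
  by_contra! hcon
  choose θ a ha hal havoid hfar using fun n : ℕ => hcon (N₁ + n) (Nat.le_add_right _ _)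
  have hcomp : IsCompact (Set.Icc (0 : ℝ) 1 ×ˢ Set.Icc (0 : ℝ) 1) :=
    isCompact_Icc.prod isCompact_Icc
  obtain ⟨⟨θ', a'⟩, -, φ, hφ, hlim⟩ := hcomp.tendsto_subseq (x := fun n => (Int.fract (θ n), a n))
    fun n => ⟨⟨Int.fract_nonneg _, (Int.fract_lt_one _).le⟩, ha n, by
      have : 0 < 1 / (l : ℝ) := by positivity
      linarith [hal n]⟩
  have hθ : Tendsto (fun n => Int.fract (θ (φ n))) atTop (nhds θ') :=
    (continuous_fst.tendsto _).comp hlim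
  have haφ : Tendsto (fun n => a (φ n)) atTop (nhds a') :=
    (continuous_snd.tendsto _).comp hlim
  have ha' : 0 ≤ a' := ge_of_tendsto' haφ fun n => ha _
  have hal' : a' + 1 / (l : ℝ) ≤ 1 := le_of_tendsto' (haφ.add_const _) fun n => hal _
  obtain ⟨r, q, hr, hq0, hql, p, hp⟩ := exists_relation_of_avoids hl0 hα
      (N := N₁) (θ := θ') hε ha' hal' (by
    intro m hm hmα hmem
    have hlo : ∀ᶠ n in atTop, a (φ n) < m * Int.fract (θ (φ n)) - ⌊m * θ'⌋ :=
      haφ.eventually_lt ((hθ.const_mul (m : ℝ)).sub_const _) hmem.1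
    have hhi : ∀ᶠ n in atTop, m * Int.fract (θ (φ n)) - ⌊m * θ'⌋ < a (φ n) + 1 / (l : ℝ) :=
      ((hθ.const_mul (m : ℝ)).sub_const _).eventually_lt (haφ.add_const _) hmem.2
    obtain ⟨n, h1, h2, h3⟩ := (hlo.and (hhi.and (eventually_ge_atTop m))).exists
    refine havoid (φ n) m hm (by have := hφ.id_le n; simp at this; omega) hmα ?_
    have hfr : Int.fract (m * θ (φ n)) = m * Int.fract (θ (φ n)) - ⌊m * θ'⌋ := by
      refine Int.fract_eq_iff.2 ⟨(ha _).trans h1.le, h2.trans_le (hal _),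
        m * ⌊θ (φ n)⌋ + ⌊m * θ'⌋, ?_⟩
      push_cast
      rw [Int.fract]
      ring
    rw [hfr]
    exact ⟨h1.le, h2⟩)
  have hdist (n : ℕ) : distToInt (∑ i, (r i : ℝ) * α i - q * θ n) =
      ‖((∑ i, (r i : ℝ) * α i - q * Int.fract (θ n) : ℝ) : UnitAddCircle)‖ := by
    have h : ((∑ i, (r i : ℝ) * α i - q * Int.fract (θ n) -
        (∑ i, (r i : ℝ) * α i - q * θ n) : ℝ) : UnitAddCircle) = 0 :=
      (UnitAddCircle.coe_eq_zero_iff_exists_int _).2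
        ⟨q * ⌊θ n⌋, by push_cast; rw [Int.fract]; ring⟩
    rw [AddCircle.coe_sub, sub_eq_zero] at h
    rw [← norm_coe_unitAddCircle, h]
  have hlim0 : Tendsto (fun n => ‖((∑ i, (r i : ℝ) * α i - q * Int.fract (θ (φ n)) : ℝ) :
      UnitAddCircle)‖) atTop (nhds ‖((∑ i, (r i : ℝ) * α i - q * θ' : ℝ) : UnitAddCircle)‖) :=
    ((continuous_norm.comp (AddCircle.continuous_mk' 1)).tendsto _).comp
      ((hθ.const_mul (q : ℝ)).const_sub _)
  rw [(UnitAddCircle.coe_eq_zero_iff_exists_int _).2 ⟨p, hp⟩, norm_zero] at hlim0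
  have := ge_of_tendsto' hlim0 fun n => (hfar (φ n) r q hr hq0 hql).trans (hdist (φ n)).le
  linarith
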